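/- Let E = ℂ ⊕ γ^{a₁} ⊕ ⋯ ⊕ γ^{a_m} be a Whitney sum of line bundles over ℂPⁿ with γ the tautological bundle, and suppose integers A, a₁,…,a_m satisfy (1 − A x)·∏_{j=1}^m (1 − (A + a_j) x) = ∏_{j=1}^m (1 + a_j x) in ℤ[x]/⟨x^{n+1}⟩. Then the dual bundle twisted by γ^{−A} satisfies E* ⊗ γ^{−A} ≅ E as complex vector bundles over ℂPⁿ. -/

import Mathlib

open Polynomial

namespace Stmt19


/-- squared Euclidean norm as a complex valued function -/
noncomputable def nrm {n : ℕ} (v : Fin (n + 1) → ℂ) : ℂ := ∑ i, v i * (starRingEnd ℂ) (v i)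

lemma nrm_eq {n : ℕ} (v : Fin (n + 1) → ℂ) : nrm v = ((∑ i, Complex.normSq (v i) : ℝ) : ℂ) := by
  simp [nrm, Complex.mul_conj]

lemma nrm_ne {n : ℕ} {v : Fin (n + 1) → ℂ} (hv : v ≠ 0) : nrm v ≠ 0 := by
  rw [nrm_eq]
  obtain ⟨i, hi⟩ := Function.ne_iff.1 hv
  have : 0 < ∑ i, Complex.normSq (v i) :=
    Finset.sum_pos' (fun i _ => Complex.normSq_nonneg _) ⟨i, Finset.mem_univ _, Complex.normSq_pos.2 hi⟩
  exact_mod_cast this.ne'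

/-- `C¹` functions on the punctured space that are homogeneous of weight `d`. -/
def Sec (n : ℕ) (d : ℤ) (f : (Fin (n + 1) → ℂ) → ℂ) : Prop :=
  (∀ v, v ≠ 0 → ContDiffAt ℝ 1 f v) ∧ ∀ ζ : ℂ, ζ ≠ 0 → ∀ v, v ≠ 0 → f (ζ • v) = ζ ^ d * f v

variable {n : ℕ}

lemma Sec.zero (d : ℤ) : Sec n d (fun _ => 0) :=
  ⟨fun _ _ => contDiffAt_const, by simp⟩

lemma Sec.const (a : ℂ) : Sec n 0 (fun _ => a) :=
  ⟨fun _ _ => contDiffAt_const, by simp⟩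

lemma Sec.add {d : ℤ} {f g : (Fin (n + 1) → ℂ) → ℂ} (hf : Sec n d f) (hg : Sec n d g) :
    Sec n d (fun v => f v + g v) :=
  ⟨fun v hv => (hf.1 v hv).add (hg.1 v hv), fun ζ hζ v hv => by
    simp only [hf.2 ζ hζ v hv, hg.2 ζ hζ v hv]; ring⟩

lemma Sec.neg {d : ℤ} {f : (Fin (n + 1) → ℂ) → ℂ} (hf : Sec n d f) :
    Sec n d (fun v => - f v) :=
  ⟨fun v hv => (hf.1 v hv).neg, fun ζ hζ v hv => by
    simp only [hf.2 ζ hζ v hv]; ring⟩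

lemma Sec.mul {d e k : ℤ} {f g : (Fin (n + 1) → ℂ) → ℂ} (hf : Sec n d f) (hg : Sec n e g)
    (hk : d + e = k) :
    Sec n k (fun v => f v * g v) :=
  ⟨fun v hv => (hf.1 v hv).mul (hg.1 v hv), fun ζ hζ v hv => by
    simp only [hf.2 ζ hζ v hv, hg.2 ζ hζ v hv, ← hk, zpow_add₀ hζ]; ring⟩

lemma Sec.sum {ι : Type*} {s : Finset ι} {d : ℤ} {f : ι → (Fin (n + 1) → ℂ) → ℂ}
    (hf : ∀ i ∈ s, Sec n d (f i)) : Sec n d (fun v => ∑ i ∈ s, f i v) :=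
  ⟨fun v hv => ContDiffAt.sum fun i hi => (hf i hi).1 v hv, fun ζ hζ v hv => by
    rw [Finset.mul_sum]; exact Finset.sum_congr rfl fun i hi => (hf i hi).2 ζ hζ v hv⟩

lemma Sec.inv {d : ℤ} {f : (Fin (n + 1) → ℂ) → ℂ} (hf : Sec n d f)
    (h0 : ∀ v, v ≠ 0 → f v ≠ 0) : Sec n (-d) (fun v => (f v)⁻¹) :=
  ⟨fun v hv => (hf.1 v hv).inv (h0 v hv), fun ζ hζ v hv => by
    simp only [hf.2 ζ hζ v hv, mul_inv, zpow_neg]⟩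

lemma Sec.pow {d : ℤ} {f : (Fin (n + 1) → ℂ) → ℂ} (hf : Sec n d f) (k : ℕ) :
    Sec n (k * d) (fun v => f v ^ k) := by
  induction k with
  | zero => simpa using Sec.const (n := n) 1
  | succ k ih =>
    simp only [pow_succ]
    exact ih.mul hf (by push_cast; ring)

lemma Sec.coord (i : Fin (n + 1)) : Sec n 1 (fun v => v i) :=
  ⟨fun v _ => by fun_prop, by simp⟩

lemma contDiff_conj : ContDiff ℝ 1 (fun z : ℂ => (starRingEnd ℂ) z) :=
  Complex.conjCLE.contDiff

lemma contDiffAt_nrm (v : Fin (n + 1) → ℂ) : ContDiffAt ℝ 1 (nrm (n := n)) v := by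
  unfold nrm
  refine ContDiffAt.sum fun i _ => ?_
  have h : ContDiffAt ℝ 1 (fun v : Fin (n + 1) → ℂ => v i) v := by fun_prop
  exact h.mul (contDiff_conj.contDiffAt.comp v h)

lemma nrm_smul (ζ : ℂ) (v : Fin (n + 1) → ℂ) :
    nrm (ζ • v) = ζ * (starRingEnd ℂ) ζ * nrm v := by
  simp only [nrm, Finset.mul_sum, Pi.smul_apply, smul_eq_mul, map_mul]
  exact Finset.sum_congr rfl fun i _ => by ring

/-- dual section -/
lemma Sec.star {d : ℤ} {f : (Fin (n + 1) → ℂ) → ℂ} (hf : Sec n d f) :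
    Sec n (-d) (fun v => (starRingEnd ℂ) (f v) * nrm v ^ (-d)) := by
  refine ⟨fun v hv => (contDiff_conj.contDiffAt.comp v (hf.1 v hv)).mul ?_, fun ζ hζ v hv => ?_⟩
  · have hz : ContDiffAt ℝ 1 (fun z : ℂ => z ^ (-d)) (nrm v) := by
      rcases Int.eq_nat_or_neg (-d) with ⟨k, hk | hk⟩
      · rw [hk]; simp only [zpow_natCast]; fun_prop
      · rw [hk]; simp only [zpow_neg, zpow_natCast]
        exact ContDiffAt.inv (by fun_prop) (pow_ne_zero _ (nrm_ne hv))
    exact hz.comp v (contDiffAt_nrm v)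
  · have h2 : (starRingEnd ℂ) ζ ≠ 0 := by simpa using hζ
    simp only [hf.2 ζ hζ v hv, nrm_smul, map_mul, map_zpow₀, mul_zpow]
    have : (starRingEnd ℂ) ζ ^ d * (starRingEnd ℂ) ζ ^ (-d) = 1 := by
      rw [← zpow_add₀ h2]; simp
    linear_combination (ζ ^ (-d) * (starRingEnd ℂ) (f v) * nrm v ^ (-d)) * this

/-- dual coordinates -/
noncomputable def dcoord (i : Fin (n + 1)) (v : Fin (n + 1) → ℂ) : ℂ :=
  (starRingEnd ℂ) (v i) * nrm v ^ (-1 : ℤ)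

lemma Sec.dcoord (i : Fin (n + 1)) : Sec n (-1) (dcoord i) := (Sec.coord i).star

lemma sum_dcoord {v : Fin (n + 1) → ℂ} (hv : v ≠ 0) : ∑ i, v i * dcoord i v = 1 := by
  simp only [Stmt19.dcoord, ← mul_assoc, ← Finset.sum_mul]
  have := nrm_ne hv
  rw [← nrm]
  simp [this]

lemma exists_gen (d : ℤ) : ∃ σ : Fin (n + 1) → (Fin (n + 1) → ℂ) → ℂ,
    (∀ i, Sec n d (σ i)) ∧ ∀ i v, v ≠ 0 → v i ≠ 0 → σ i v ≠ 0 := by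
  rcases Int.eq_nat_or_neg d with ⟨k, rfl | rfl⟩
  · refine ⟨fun i v => v i ^ k, fun i => by simpa using (Sec.coord i).pow k, fun i v _ h => pow_ne_zero _ h⟩
  · refine ⟨fun i v => Stmt19.dcoord i v ^ k, fun i => by simpa using (Sec.dcoord i).pow k,
      fun i v hv h => pow_ne_zero _ ?_⟩
    exact mul_ne_zero (by simpa using h) (zpow_ne_zero _ (nrm_ne hv))

/-- a nowhere vanishing tuple has a left inverse -/
lemma exists_dual {κ : Type} [Fintype κ] (d : κ → ℤ) (u : κ → (Fin (n + 1) → ℂ) → ℂ)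
    (hu : ∀ k, Sec n (d k) (u k)) (h0 : ∀ v, v ≠ 0 → ∃ k, u k v ≠ 0) :
    ∃ y : κ → (Fin (n + 1) → ℂ) → ℂ, (∀ k, Sec n (-d k) (y k)) ∧
      ∀ v, v ≠ 0 → ∑ k, y k v * u k v = 1 := by
  set q : (Fin (n + 1) → ℂ) → ℂ :=
    fun v => ∑ k, ((starRingEnd ℂ) (u k v) * nrm v ^ (-d k)) * u k v with hq
  have hqS : Sec n 0 q := Sec.sum fun k _ => (hu k).star.mul (hu k) (by ring)
  have hq0 : ∀ v, v ≠ 0 → q v ≠ 0 := by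
    intro v hv
    obtain ⟨i, hi⟩ := Function.ne_iff.1 hv
    have hN : 0 < ∑ i, Complex.normSq (v i) :=
      Finset.sum_pos' (fun i _ => Complex.normSq_nonneg _)
        ⟨i, Finset.mem_univ _, Complex.normSq_pos.2 hi⟩
    obtain ⟨k, hk⟩ := h0 v hv
    have hP : 0 < ∑ k, Complex.normSq (u k v) * (∑ i, Complex.normSq (v i)) ^ (-d k) :=
      Finset.sum_pos' (fun k _ => mul_nonneg (Complex.normSq_nonneg _) (zpow_pos hN _).le)
        ⟨k, Finset.mem_univ _, mul_pos (Complex.normSq_pos.2 hk) (zpow_pos hN _)⟩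
    have : q v = ((∑ k, Complex.normSq (u k v) * (∑ i, Complex.normSq (v i)) ^ (-d k) : ℝ) : ℂ) := by
      simp only [hq, nrm_eq]
      push_cast
      refine Finset.sum_congr rfl fun k _ => ?_
      rw [← Complex.mul_conj]; ring
    rw [this]
    exact_mod_cast hP.ne'
  refine ⟨fun k v => ((starRingEnd ℂ) (u k v) * nrm v ^ (-d k)) * (q v)⁻¹,
    fun k => (hu k).star.mul (hqS.inv hq0) (by ring), fun v hv => ?_⟩
  have : ∑ k, ((starRingEnd ℂ) (u k v) * nrm v ^ (-d k)) * (q v)⁻¹ * u k v = q v * (q v)⁻¹ := by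
    rw [hq, Finset.sum_mul]
    exact Finset.sum_congr rfl fun k _ => by ring
  rw [this, mul_inv_cancel₀ (hq0 v hv)]

/-- general position -/
lemma exists_avoid {κ : Type} [Fintype κ] (hcard : n < Fintype.card κ) (d : κ → ℤ)
    (u : κ → (Fin (n + 1) → ℂ) → ℂ) (w : (Fin (n + 1) → ℂ) → ℂ)
    (hu : ∀ k, Sec n (d k) (u k)) (hw : Sec n 0 w)
    (h0 : ∀ v, v ≠ 0 → w v = 0 → ∃ k, u k v ≠ 0) :
    ∃ t : κ → (Fin (n + 1) → ℂ) → ℂ, (∀ k, Sec n (d k) (t k)) ∧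
      ∀ v, v ≠ 0 → ∃ k, u k v + w v * t k v ≠ 0 := by
  choose σ hσ hσ0 using fun k => exists_gen (n := n) (d k)
  let pt : Fin (n + 1) → (Fin n → ℂ) → (Fin (n + 1) → ℂ) := fun i z => i.insertNth (α := fun _ => ℂ) 1 z
  have hpt : ∀ i z, pt i z ≠ 0 := fun i z h => by
    have := congrFun h i
    simp [pt] at this
  let F : Fin (n + 1) → ((Fin n → ℂ) × (κ → Fin n → ℂ)) → (κ → Fin (n + 1) → ℂ) := fun i p k =>
    i.insertNth (α := fun _ => ℂ) ((-(u k (pt i p.1) / w (pt i p.1)) - ∑ i' : Fin n, p.2 k i' * σ k (i.succAbove i') (pt i p.1))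
      / σ k i (pt i p.1)) (p.2 k)
  let S : Fin (n + 1) → Set ((Fin n → ℂ) × (κ → Fin n → ℂ)) := fun i => {p | w (pt i p.1) ≠ 0}
  have hptC : ∀ i, ContDiff ℝ 1 (fun p : ((Fin n → ℂ) × (κ → Fin n → ℂ)) => pt i p.1) := by
    intro i
    rw [contDiff_pi]
    intro j
    rcases Fin.eq_self_or_eq_succAbove i j with rfl | ⟨j, rfl⟩
    · simp only [pt, Fin.insertNth_apply_same]; fun_prop
    · simp only [pt, Fin.insertNth_apply_succAbove]; fun_prop
  have hcomp : ∀ i {e : ℤ} {f : (Fin (n + 1) → ℂ) → ℂ}, Sec n e f → ∀ p : ((Fin n → ℂ) × (κ → Fin n → ℂ)),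
      ContDiffAt ℝ 1 (fun p : ((Fin n → ℂ) × (κ → Fin n → ℂ)) => f (pt i p.1)) p := fun i e f hf p =>
    ContDiffAt.comp p (hf.1 _ (hpt i p.1)) (hptC i).contDiffAt
  have hF : ∀ i, ∀ p ∈ S i, ContDiffAt ℝ 1 (F i) p := by
    intro i p hp
    rw [contDiffAt_pi]
    intro k
    rw [contDiffAt_pi]
    intro j
    rcases Fin.eq_self_or_eq_succAbove i j with hj | ⟨j, rfl⟩
    · rw [hj]
      simp only [F, Fin.insertNth_apply_same]
      have h1 := hcomp i (hu k) p
      have h2 := (hcomp i hw p).inv hp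
      have h3 := (hcomp i (hσ k i) p).inv (hσ0 k i _ (hpt _ _) (by simp [pt]))
      have h4 : ContDiffAt ℝ 1 (fun p : ((Fin n → ℂ) × (κ → Fin n → ℂ)) =>
          ∑ i' : Fin n, p.2 k i' * σ k (i.succAbove i') (pt i p.1)) p :=
        ContDiffAt.sum fun i' _ => ContDiffAt.mul (by fun_prop) (hcomp i (hσ k _) p)
      simp only [div_eq_mul_inv]
      exact ((h1.mul h2).neg.sub h4).mul h3
    · simp only [F, Fin.insertNth_apply_succAbove]; fun_prop
  have hdim : dimH (⋃ i, F i '' S i) < Module.finrank ℝ (κ → Fin (n + 1) → ℂ) := by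
    have h1 : dimH (⋃ i, F i '' S i) ≤ Module.finrank ℝ ((Fin n → ℂ) × (κ → Fin n → ℂ)) := by
      rw [dimH_iUnion]
      refine iSup_le fun i => ?_
      refine (dimH_image_le_of_locally_lipschitzOn fun p hp => ?_).trans ?_
      · obtain ⟨K, t, ht, hL⟩ := (hF i p hp).exists_lipschitzOnWith
        exact ⟨K, t, mem_nhdsWithin_of_mem_nhds ht, hL⟩
      · exact (dimH_mono (Set.subset_univ _)).trans (Real.dimH_univ_eq_finrank ((Fin n → ℂ) × (κ → Fin n → ℂ))).le
    refine h1.trans_lt ?_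
    have e1 : Module.finrank ℝ ((Fin n → ℂ) × (κ → Fin n → ℂ)) = n * 2 + Fintype.card κ * (n * 2) := by
      simp [Module.finrank_prod, Module.finrank_pi_fintype, Complex.finrank_real_complex]
    have e2 : Module.finrank ℝ (κ → Fin (n + 1) → ℂ) = Fintype.card κ * ((n + 1) * 2) := by
      simp [Module.finrank_pi_fintype, Complex.finrank_real_complex]
    rw [e1, e2]
    norm_cast
    nlinarith
  obtain ⟨T, hT⟩ := (dense_compl_of_dimH_lt_finrank hdim).nonempty
  refine ⟨fun k v => ∑ i, T k i * σ k i v, fun k => Sec.sum fun i _ =>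
    (Sec.const (T k i)).mul (hσ k i) (by ring), fun v hv => ?_⟩
  by_contra! hcon
  have hwv : w v ≠ 0 := fun h => by
    obtain ⟨k, hk⟩ := h0 v hv h
    have := hcon k
    rw [h] at this
    simp at this
    exact hk this
  obtain ⟨i, hi⟩ := Function.ne_iff.1 hv
  have hi : v i ≠ 0 := hi
  apply hT
  refine Set.mem_iUnion.2 ⟨i, ?_⟩
  set v' := (v i)⁻¹ • v with hv'
  have hii := inv_ne_zero hi
  have hpv : pt i (i.removeNth v') = v' := by
    have : (1 : ℂ) = v' i := by simp [hv', hi]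
    simp only [pt]
    rw [this]
    exact Fin.insertNth_self_removeNth i v'
  have hv'0 : v' ≠ 0 := hpv ▸ hpt _ _
  have hw' : w v' ≠ 0 := by rw [hv', hw.2 _ hii v hv]; simpa using hwv
  have hcon' : ∀ k, u k v' + w v' * ∑ i, T k i * σ k i v' = 0 := by
    intro k
    have hs : Sec n (d k) (fun v => u k v + w v * ∑ i, T k i * σ k i v) :=
      (hu k).add (hw.mul (Sec.sum fun i _ => (Sec.const (T k i)).mul (hσ k i) (by ring)) (by ring))
    have := hs.2 _ hii v hv
    simp only [hcon k, mul_zero] at this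
    exact this
  refine ⟨(i.removeNth v', fun k => i.removeNth (T k)), ?_, ?_⟩
  · show w (pt i (i.removeNth v')) ≠ 0
    rw [hpv]; exact hw'
  · funext k
    have hs0 : σ k i v' ≠ 0 := hσ0 k i v' hv'0 (by simp [hv', hi])
    simp only [F, hpv]
    refine Eq.trans ?_ (Fin.insertNth_self_removeNth i (T k))
    congr 1
    · rw [div_eq_iff hs0]
      have := hcon' k
      rw [Fin.sum_univ_succAbove _ i] at this
      simp only [Fin.removeNth]
      field_simp
      linear_combination -this



set_option linter.unusedSectionVars false
set_option linter.unusedSimpArgs false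

/-- matrix of sections of `Hom(γ^c, γ^c')`. -/
def MSec (n : ℕ) {ι κ : Type} (c : ι → ℤ) (c' : κ → ℤ)
    (G : (Fin (n + 1) → ℂ) → Matrix κ ι ℂ) : Prop :=
  ∀ k j, Sec n (c' k - c j) (fun v => G v k j)

lemma MSec.mul {ι κ μ : Type} [Fintype κ] {c : ι → ℤ} {c' : κ → ℤ} {c'' : μ → ℤ}
    {G : (Fin (n + 1) → ℂ) → Matrix κ ι ℂ} {G' : (Fin (n + 1) → ℂ) → Matrix μ κ ℂ}
    (hG : MSec n c c' G) (hG' : MSec n c' c'' G') : MSec n c c'' (fun v => G' v * G v) := by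
  intro k j
  simp only [Matrix.mul_apply]
  exact Sec.sum fun i _ => (hG' k i).mul (hG i j) (by ring)

lemma MSec.scalar {ι : Type} [DecidableEq ι] {c c' : ι → ℤ} {f : (Fin (n + 1) → ℂ) → ℂ} {d : ℤ}
    (hf : Sec n d f) (hc : ∀ j, c' j - c j = d) : MSec n c c' (fun v => f v • 1) := by
  intro k j
  simp only [Matrix.smul_apply, Matrix.one_apply, smul_eq_mul]
  by_cases h : k = j
  · subst h; simpa [hc] using hf
  · simpa [h] using Sec.zero _

lemma MSec.one {ι : Type} [DecidableEq ι] {c : ι → ℤ} : MSec n c c (fun _ => 1) := by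
  simpa using MSec.scalar (c := c) (c' := c) (Sec.const (n := n) 1) (by simp)

lemma MSec.zero {ι κ : Type} {c : ι → ℤ} {c' : κ → ℤ} : MSec n c c' (fun _ => 0) :=
  fun _ _ => Sec.zero _

lemma MSec.neg {ι κ : Type} {c : ι → ℤ} {c' : κ → ℤ} {G : (Fin (n + 1) → ℂ) → Matrix κ ι ℂ}
    (hG : MSec n c c' G) : MSec n c c' (fun v => - G v) :=
  fun k j => (hG k j).neg

lemma MSec.congr {ι κ : Type} {c d : ι → ℤ} {c' d' : κ → ℤ} {G : (Fin (n + 1) → ℂ) → Matrix κ ι ℂ}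
    (hG : MSec n c c' G) (h : ∀ k j, d' k - d j = c' k - c j) : MSec n d d' G :=
  fun k j => by rw [h]; exact hG k j

lemma MSec.blocks {ι κ ι' κ' : Type} {c : ι → ℤ} {c' : κ → ℤ} {d : ι' → ℤ} {d' : κ' → ℤ}
    {P : (Fin (n + 1) → ℂ) → Matrix κ ι ℂ} {Q : (Fin (n + 1) → ℂ) → Matrix κ ι' ℂ}
    {R : (Fin (n + 1) → ℂ) → Matrix κ' ι ℂ} {S : (Fin (n + 1) → ℂ) → Matrix κ' ι' ℂ}
    (hP : MSec n c c' P) (hQ : MSec n d c' Q) (hR : MSec n c d' R) (hS : MSec n d d' S) :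
    MSec n (Sum.elim c d) (Sum.elim c' d') (fun v => Matrix.fromBlocks (P v) (Q v) (R v) (S v)) := by
  rintro (k | k) (j | j)
  · exact hP k j
  · exact hQ k j
  · exact hR k j
  · exact hS k j

/-- isomorphism of sums of line bundles -/
def BIso (n : ℕ) {ι κ : Type} [Fintype ι] [Fintype κ] [DecidableEq ι] [DecidableEq κ]
    (c : ι → ℤ) (c' : κ → ℤ) : Prop :=
  ∃ (G : (Fin (n + 1) → ℂ) → Matrix κ ι ℂ) (H : (Fin (n + 1) → ℂ) → Matrix ι κ ℂ),
    MSec n c c' G ∧ MSec n c' c H ∧ ∀ v, v ≠ 0 → G v * H v = 1 ∧ H v * G v = 1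

section
variable {ι κ μ ι' κ' : Type} [Fintype ι] [Fintype κ] [Fintype μ] [DecidableEq ι] [DecidableEq κ]
  [DecidableEq μ] [Fintype ι'] [Fintype κ'] [DecidableEq ι'] [DecidableEq κ']
  {c : ι → ℤ} {c' : κ → ℤ} {c'' : μ → ℤ} {d : ι' → ℤ} {d' : κ' → ℤ}

lemma BIso.refl (c : ι → ℤ) : BIso n c c :=
  ⟨fun _ => 1, fun _ => 1, MSec.one, MSec.one, by simp⟩

lemma BIso.symm (h : BIso n c c') : BIso n c' c := by
  obtain ⟨G, H, hG, hH, h⟩ := h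
  exact ⟨H, G, hH, hG, fun v hv => (h v hv).symm⟩

lemma BIso.trans (h : BIso n c c') (h' : BIso n c' c'') : BIso n c c'' := by
  obtain ⟨G, H, hG, hH, h⟩ := h
  obtain ⟨G', H', hG', hH', h'⟩ := h'
  refine ⟨_, _, hG.mul hG', hH'.mul hH, fun v hv => ⟨?_, ?_⟩⟩
  · rw [Matrix.mul_assoc, ← Matrix.mul_assoc (G v), (h v hv).1, Matrix.one_mul, (h' v hv).1]
  · rw [Matrix.mul_assoc, ← Matrix.mul_assoc (H' v), (h' v hv).2, Matrix.one_mul, (h v hv).2]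

lemma BIso.sum (h : BIso n c c') (h' : BIso n d d') : BIso n (Sum.elim c d) (Sum.elim c' d') := by
  obtain ⟨G, H, hG, hH, h⟩ := h
  obtain ⟨G', H', hG', hH', h'⟩ := h'
  refine ⟨_, _, hG.blocks MSec.zero MSec.zero hG', hH.blocks MSec.zero MSec.zero hH',
    fun v hv => ⟨?_, ?_⟩⟩
  · simp [Matrix.fromBlocks_multiply, (h v hv).1, (h' v hv).1]
  · simp [Matrix.fromBlocks_multiply, (h v hv).2, (h' v hv).2]

lemma BIso.of_equiv (e : ι ≃ κ) (he : ∀ j, c' (e j) = c j) : BIso n c c' := by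
  refine ⟨fun _ => (1 : Matrix κ κ ℂ).submatrix id e, fun _ => (1 : Matrix κ κ ℂ).submatrix e id,
    ?_, ?_, fun v _ => ⟨?_, ?_⟩⟩
  · intro k j
    simp only [Matrix.submatrix_apply, Matrix.one_apply, id]
    by_cases h : k = e j
    · subst h; simpa [he] using Sec.const 1
    · simpa [h] using Sec.zero _
  · intro j k
    simp only [Matrix.submatrix_apply, Matrix.one_apply, id]
    by_cases h : e j = k
    · subst h; simpa [he] using Sec.const 1
    · simpa [h] using Sec.zero _
  · rw [Matrix.submatrix_mul_equiv]; simp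
  · rw [← Matrix.submatrix_mul _ _ e id e Function.bijective_id]; simp

lemma BIso.shift (h : BIso n c c') (k : ℤ) : BIso n (fun j => c j + k) (fun j => c' j + k) := by
  obtain ⟨G, H, hG, hH, h⟩ := h
  exact ⟨G, H, hG.congr (by intros; ring), hH.congr (by intros; ring), h⟩

/-- equal generating functions -/
lemma exists_equiv_of_sum_eq {c : ι → ℕ} {c' : κ → ℕ}
    (h : ∑ j, (X : ℤ[X]) ^ c j = ∑ k, X ^ c' k) : ∃ e : ι ≃ κ, ∀ j, c' (e j) = c j := by
  have : ∀ a, Nonempty ({j // c j = a} ≃ {k // c' k = a}) := by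
    intro a
    rw [← Fintype.card_eq, Fintype.card_subtype, Fintype.card_subtype]
    have := congrArg (fun p => p.coeff a) h
    simp only [finsetSum_coeff, coeff_X_pow] at this
    simp only [Finset.sum_boole, eq_comm (a := a)] at this
    exact_mod_cast this
  exact ⟨Equiv.ofFiberEquiv fun a => (this a).some, fun j => Equiv.ofFiberEquiv_map _ j⟩

/-- an isomorphism fixing the last basis vector descends to the quotient -/
lemma BIso.cancel_aux (l : ℤ) (G : (Fin (n + 1) → ℂ) → Matrix (κ ⊕ Unit) (ι ⊕ Unit) ℂ)
    (H : (Fin (n + 1) → ℂ) → Matrix (ι ⊕ Unit) (κ ⊕ Unit) ℂ)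
    (hG : MSec n (Sum.elim c fun _ => l) (Sum.elim c' fun _ => l) G)
    (hH : MSec n (Sum.elim c' fun _ => l) (Sum.elim c fun _ => l) H)
    (h : ∀ v, v ≠ 0 → G v * H v = 1 ∧ H v * G v = 1)
    (h1 : ∀ v, v ≠ 0 → ∀ k, G v (Sum.inl k) (Sum.inr ()) = 0)
    (h2 : ∀ v, v ≠ 0 → G v (Sum.inr ()) (Sum.inr ()) = 1) : BIso n c c' := by
  refine ⟨fun v => (G v).toBlocks₁₁, fun v => (H v).toBlocks₁₁, fun k j => hG (Sum.inl k) (Sum.inl j),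
    fun k j => hH (Sum.inl k) (Sum.inl j), fun v hv => ?_⟩
  obtain ⟨ha, hb⟩ := h v hv
  have g12 : (G v).toBlocks₁₂ = 0 := by ext k ⟨⟩; exact h1 v hv k
  have g22 : (G v).toBlocks₂₂ = 1 := by ext ⟨⟩ ⟨⟩; simpa [Matrix.toBlocks₂₂] using h2 v hv
  rw [← Matrix.fromBlocks_toBlocks (G v), ← Matrix.fromBlocks_toBlocks (H v), g12, g22,
    Matrix.fromBlocks_multiply, ← Matrix.fromBlocks_one, Matrix.fromBlocks_inj] at ha hb
  have h12 : (H v).toBlocks₁₂ = 0 := by simpa using hb.2.1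
  constructor
  · simpa using ha.1
  · simpa [h12] using hb.1

/-- upper elementary matrix -/
def upM (Z : Matrix κ Unit ℂ) : Matrix (κ ⊕ Unit) (κ ⊕ Unit) ℂ := Matrix.fromBlocks 1 Z 0 1

/-- lower elementary matrix -/
def loM (Z : Matrix Unit κ ℂ) : Matrix (κ ⊕ Unit) (κ ⊕ Unit) ℂ := Matrix.fromBlocks 1 0 Z 1

lemma BIso.cancel (hcard : n < Fintype.card κ) (l : ℤ)
    (h : BIso n (Sum.elim c fun _ : Unit => l) (Sum.elim c' fun _ : Unit => l)) : BIso n c c' := by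
  obtain ⟨G, H, hG, hH, h⟩ := h
  obtain ⟨t, ht, ht0⟩ := exists_avoid hcard (fun k => c' k - l) (fun k v => G v (Sum.inl k) (Sum.inr ()))
    (fun v => G v (Sum.inr ()) (Sum.inr ())) (fun k => hG (Sum.inl k) (Sum.inr ()))
    (by simpa using hG (Sum.inr ()) (Sum.inr ()))
    (by
      intro v hv h0
      by_contra! hc
      have h3 := congrFun (congrFun (h v hv).2 (Sum.inr ())) (Sum.inr ())
      rw [Matrix.mul_apply] at h3
      simp [h0, hc] at h3)
  have hw : Sec n 0 (fun v => G v (Sum.inr ()) (Sum.inr ())) := by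
    simpa using hG (Sum.inr ()) (Sum.inr ())
  have hu : ∀ k, Sec n (c' k - l) (fun v => G v (Sum.inl k) (Sum.inr ()) +
      G v (Sum.inr ()) (Sum.inr ()) * t k v) :=
    fun k => Sec.add (hG (Sum.inl k) (Sum.inr ())) (hw.mul (ht k) (by ring))
  obtain ⟨y, hy, hy1⟩ := exists_dual _ _ hu ht0
  -- the three elementary matrices
  let T : (Fin (n + 1) → ℂ) → Matrix κ Unit ℂ := fun v => Matrix.of fun k _ => t k v
  let U : (Fin (n + 1) → ℂ) → Matrix κ Unit ℂ := fun v => Matrix.of fun k _ =>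
    G v (Sum.inl k) (Sum.inr ()) + G v (Sum.inr ()) (Sum.inr ()) * t k v
  let Y : (Fin (n + 1) → ℂ) → Matrix Unit κ ℂ := fun v => Matrix.of fun _ k =>
    (1 + -G v (Sum.inr ()) (Sum.inr ())) * y k v
  have hT : MSec n (fun _ => l) c' T := fun k _ => ht k
  have hU : MSec n (fun _ => l) c' U := fun k _ => hu k
  have hY : MSec n c' (fun _ => l) Y := fun _ k =>
    ((Sec.const 1).add hw.neg).mul (hy k) (by ring)
  have hUp : ∀ {Z : (Fin (n + 1) → ℂ) → Matrix κ Unit ℂ}, MSec n (fun _ => l) c' Z →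
      MSec n (Sum.elim c' fun _ : Unit => l) (Sum.elim c' fun _ : Unit => l)
        (fun v => upM (Z v)) := fun hZ =>
    MSec.blocks MSec.one hZ MSec.zero MSec.one
  have hLo : ∀ {Z : (Fin (n + 1) → ℂ) → Matrix Unit κ ℂ}, MSec n c' (fun _ => l) Z →
      MSec n (Sum.elim c' fun _ : Unit => l) (Sum.elim c' fun _ : Unit => l)
        (fun v => loM (Z v)) := fun hZ =>
    MSec.blocks MSec.one MSec.zero hZ MSec.one
  have inv3 : ∀ (v) (hv : v ≠ 0),
      (upM (-U v) * (loM (Y v) *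
        (upM (T v) * G v))) *
      (H v * upM (-T v) * loM (-Y v)
        * upM (U v)) = 1 := by
    intro v hv
    have e1 : (upM (T v)) *
      upM (-T v) = 1 := by simp [upM, loM, Matrix.fromBlocks_multiply]
    have e2 : (loM (Y v)) *
      loM (-Y v) = 1 := by simp [upM, loM, Matrix.fromBlocks_multiply]
    have e3 : (upM (-U v)) *
      upM (U v) = 1 := by simp [upM, loM, Matrix.fromBlocks_multiply]
    simp only [Matrix.mul_assoc]
    rw [← Matrix.mul_assoc (G v), (h v hv).1, Matrix.one_mul, ← Matrix.mul_assoc (upM (T v)),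
      e1, Matrix.one_mul, ← Matrix.mul_assoc (loM (Y v)), e2, Matrix.one_mul, e3]
  have inv4 : ∀ (v) (hv : v ≠ 0),
      (H v * upM (-T v) * loM (-Y v)
        * upM (U v)) *
      (upM (-U v) * (loM (Y v) *
        (upM (T v) * G v))) = 1 := by
    intro v hv
    have e1 : (upM (-T v)) *
      upM (T v) = 1 := by simp [upM, loM, Matrix.fromBlocks_multiply]
    have e2 : (loM (-Y v)) *
      loM (Y v) = 1 := by simp [upM, loM, Matrix.fromBlocks_multiply]
    have e3 : (upM (U v)) *
      upM (-U v) = 1 := by simp [upM, loM, Matrix.fromBlocks_multiply]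
    simp only [Matrix.mul_assoc]
    rw [← Matrix.mul_assoc (upM (U v)), e3, Matrix.one_mul,
      ← Matrix.mul_assoc (loM (-Y v)), e2, Matrix.one_mul,
      ← Matrix.mul_assoc (upM (-T v)), e1, Matrix.one_mul, (h v hv).2]
  have col : ∀ (v) (hv : v ≠ 0), ∀ x, (upM (-U v) * (loM (Y v) *
        (upM (T v) * G v))) x (Sum.inr ()) = Sum.elim (fun _ => 0) (fun _ => 1) x := by
    intro v hv
    have k1 : ∀ k, (upM (T v) * G v) (Sum.inl k) (Sum.inr ()) = U v k () := by
      intro k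
      rw [Matrix.mul_apply]
      simp [upM, U, T, Matrix.one_apply, mul_comm]
    have k2 : (upM (T v) * G v) (Sum.inr ()) (Sum.inr ()) =
        G v (Sum.inr ()) (Sum.inr ()) := by
      rw [Matrix.mul_apply]
      simp [upM]
    have k3 : ∀ k, (loM (Y v) * (upM (T v) * G v))
        (Sum.inl k) (Sum.inr ()) = U v k () := by
      intro k
      rw [Matrix.mul_apply]
      simp [loM, k1, Matrix.one_apply]
    have k4 : (loM (Y v) * (upM (T v) * G v))
        (Sum.inr ()) (Sum.inr ()) = 1 := by
      rw [Matrix.mul_apply]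
      have := hy1 v hv
      simp only [Fintype.sum_sum_type, k1, k2, loM, Matrix.fromBlocks_apply₂₁, Matrix.fromBlocks_apply₂₂]
      simp only [Y, U, Matrix.of_apply, mul_assoc, ← Finset.mul_sum, this]
      simp
    generalize loM (Y v) * (upM (T v) * G v) = Q at k3 k4 ⊢
    rintro (k | k)
    · rw [Matrix.mul_apply]
      simp [upM, k3, k4, Matrix.one_apply]
    · rw [Matrix.mul_apply]
      simp [upM, k3, k4]
  exact BIso.cancel_aux l _ _ (((hG.mul (hUp hT)).mul (hLo hY)).mul (hUp hU.neg))
    ((hUp hU).mul ((hLo hY.neg).mul ((hUp hT.neg).mul hH)))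
    (fun v hv => ⟨inv3 v hv, inv4 v hv⟩) (fun v hv k => col v hv _) (fun v hv => col v hv _)

end

lemma BIso.cancel_fin {ι κ : Type} [Fintype ι] [Fintype κ] [DecidableEq ι] [DecidableEq κ]
    {c : ι → ℤ} {c' : κ → ℤ} (hcard : n < Fintype.card κ) (p : ℕ) (f : Fin p → ℤ)
    (h : BIso n (Sum.elim c f) (Sum.elim c' f)) : BIso n c c' := by
  induction p with
  | zero =>
    refine BIso.trans (BIso.of_equiv (Equiv.sumEmpty ι (Fin 0)).symm ?_)
      (h.trans (BIso.of_equiv (Equiv.sumEmpty κ (Fin 0)) ?_))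
    · intro j; rfl
    · rintro (j | j)
      · rfl
      · exact j.elim0
  | succ p ih =>
    refine ih (fun i => f i.castSucc) (BIso.cancel ?_ (f (Fin.last p)) ?_)
    · simp; omega
    · have key : ∀ {ι : Type} [Fintype ι] [DecidableEq ι] (c : ι → ℤ), BIso n
          (Sum.elim (Sum.elim c fun i : Fin p => f i.castSucc) fun _ : Unit => f (Fin.last p)) (Sum.elim c f) := by
        intro ι _ _ c
        refine BIso.of_equiv ((Equiv.sumAssoc _ _ _).trans
          ((Equiv.refl ι).sumCongr (((Equiv.refl _).sumCongr (Equiv.equivPUnit (Fin 1)).symm).trans finSumFinEquiv))) ?_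
        rintro ((j | j) | j)
        · simp
        · simp; rfl
        · simp; rfl
      exact (key c).trans (h.trans (key c').symm)



/-- Koszul complex -/
lemma koszul (S : Finset (Fin (n + 1))) : ∃ (P Q : Type) (_ : Fintype P) (_ : Fintype Q)
    (_ : DecidableEq P) (_ : DecidableEq Q) (p : P → ℕ) (q : Q → ℕ)
    (G : (Fin (n + 1) → ℂ) → Matrix Q P ℂ) (H : (Fin (n + 1) → ℂ) → Matrix P Q ℂ),
    MSec n (fun j => (p j : ℤ)) (fun j => (q j : ℤ)) G ∧
    MSec n (fun j => (q j : ℤ)) (fun j => (p j : ℤ)) H ∧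
    (∀ v, v ≠ 0 → G v * H v = (∑ i ∈ S, v i * dcoord i v) • (1 : Matrix Q Q ℂ) ∧
      H v * G v = (∑ i ∈ S, v i * dcoord i v) • (1 : Matrix P P ℂ)) ∧
    ∑ j, (X : ℤ[X]) ^ p j - ∑ j, X ^ q j = (1 - X) ^ S.card := by
  induction S using Finset.induction_on with
  | empty =>
    refine ⟨Unit, Empty, inferInstance, inferInstance, inferInstance, inferInstance,
      fun _ => 0, fun _ => 0, fun _ => 0, fun _ => 0, MSec.zero, MSec.zero, ?_, ?_⟩
    · intro v _; simp
    · simp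
  | insert i S hi ih =>
    obtain ⟨P, Q, _, _, _, _, p, q, G, H, hG, hH, h, hX⟩ := ih
    have hx := Sec.coord i
    have hb := Sec.dcoord i
    refine ⟨P ⊕ Q, Q ⊕ P, inferInstance, inferInstance, inferInstance, inferInstance,
      Sum.elim p (fun j => q j + 1), Sum.elim q (fun j => p j + 1),
      fun v => Matrix.fromBlocks (G v) (dcoord i v • 1) (v i • 1) (-H v),
      fun v => Matrix.fromBlocks (H v) (dcoord i v • 1) (v i • 1) (-G v), ?_, ?_, ?_, ?_⟩
    · refine (MSec.blocks hG (MSec.scalar (c := fun j => (q j : ℤ) + 1) hb (by intro j; ring))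
        (MSec.scalar (c' := fun j => (p j : ℤ) + 1) hx (by intro j; ring))
        (hH.neg.congr (by intros; ring))).congr ?_
      rintro (j | j) (k | k) <;> simp
    · refine (MSec.blocks hH (MSec.scalar (c := fun j => (p j : ℤ) + 1) hb (by intro j; ring))
        (MSec.scalar (c' := fun j => (q j : ℤ) + 1) hx (by intro j; ring))
        (hG.neg.congr (by intros; ring))).congr ?_
      rintro (j | j) (k | k) <;> simp
    · intro v hv
      obtain ⟨ha, hb⟩ := h v hv
      rw [Finset.sum_insert hi]
      generalize ∑ i ∈ S, v i * dcoord i v = s at *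
      constructor
      · rw [Matrix.fromBlocks_multiply, ← Matrix.fromBlocks_one, Matrix.fromBlocks_smul]
        simp [ha, hb, smul_smul, ← add_smul, add_comm, mul_comm]
      · rw [Matrix.fromBlocks_multiply, ← Matrix.fromBlocks_one, Matrix.fromBlocks_smul]
        simp [ha, hb, smul_smul, ← add_smul, add_comm, mul_comm]
    · rw [Finset.card_insert_of_notMem hi, pow_succ, ← hX]
      simp only [Fintype.sum_sum_type, Sum.elim_inl, Sum.elim_inr, pow_succ, ← Finset.sum_mul]
      ring

/-- classes of stably trivial virtual bundles -/
def KSet (n : ℕ) (f : ℤ[X]) : Prop := ∃ (P Q : Type) (_ : Fintype P) (_ : Fintype Q)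
    (_ : DecidableEq P) (_ : DecidableEq Q) (p : P → ℕ) (q : Q → ℕ),
    BIso n (fun j => (p j : ℤ)) (fun j => (q j : ℤ)) ∧ ∑ j, (X : ℤ[X]) ^ p j - ∑ j, X ^ q j = f

lemma KSet.base : KSet n ((1 - X) ^ (n + 1)) := by
  obtain ⟨P, Q, _, _, _, _, p, q, G, H, hG, hH, h, hX⟩ := koszul (n := n) Finset.univ
  refine ⟨P, Q, inferInstance, inferInstance, inferInstance, inferInstance, p, q, ⟨G, H, hG, hH, fun v hv => ?_⟩, by simpa using hX⟩
  simpa [sum_dcoord hv] using h v hv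

lemma KSet.add {f g : ℤ[X]} (hf : KSet n f) (hg : KSet n g) : KSet n (f + g) := by
  obtain ⟨P, Q, _, _, _, _, p, q, h, rfl⟩ := hf
  obtain ⟨P', Q', _, _, _, _, p', q', h', rfl⟩ := hg
  refine ⟨P ⊕ P', Q ⊕ Q', inferInstance, inferInstance, inferInstance, inferInstance,
    Sum.elim p p', Sum.elim q q', ?_, ?_⟩
  · convert h.sum h' using 1
    · funext j; cases j <;> rfl
    · funext j; cases j <;> rfl
  · simp only [Fintype.sum_sum_type, Sum.elim_inl, Sum.elim_inr]; ring

lemma KSet.zero : KSet n 0 :=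
  ⟨Empty, Empty, inferInstance, inferInstance, inferInstance, inferInstance,
    fun _ => 0, fun _ => 0, BIso.refl _, by simp⟩

lemma KSet.neg {f : ℤ[X]} (hf : KSet n f) : KSet n (-f) := by
  obtain ⟨P, Q, _, _, _, _, p, q, h, rfl⟩ := hf
  exact ⟨Q, P, _, _, _, _, q, p, h.symm, by ring⟩

lemma KSet.shift {f : ℤ[X]} (hf : KSet n f) (k : ℕ) : KSet n (X ^ k * f) := by
  obtain ⟨P, Q, _, _, _, _, p, q, h, rfl⟩ := hf
  refine ⟨P, Q, _, _, _, _, fun j => p j + k, fun j => q j + k, by simpa using h.shift k, ?_⟩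
  simp only [pow_add, ← Finset.sum_mul]; ring

lemma KSet.mul {f : ℤ[X]} (hf : KSet n f) (g : ℤ[X]) : KSet n (g * f) := by
  induction g using Polynomial.induction_on' with
  | add p q hp hq => rw [add_mul]; exact hp.add hq
  | monomial k a =>
    let K : AddSubgroup ℤ[X] := ⟨⟨⟨{f | KSet n f}, fun ha hb => KSet.add ha hb⟩, KSet.zero⟩, fun h => KSet.neg h⟩
    have h1 : X ^ k * f ∈ K := hf.shift k
    have h2 : a • (X ^ k * f) ∈ K := K.zsmul_mem h1 a
    have : monomial k a * f = a • (X ^ k * f) := by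
      rw [← C_mul_X_pow_eq_monomial, zsmul_eq_mul, mul_assoc]; simp
    rw [this]; exact h2

lemma stable {ι κ : Type} [Fintype ι] [Fintype κ] [DecidableEq ι] [DecidableEq κ]
    (hcard : n < Fintype.card κ) (c : ι → ℕ) (c' : κ → ℕ)
    (h : (1 - X : ℤ[X]) ^ (n + 1) ∣ ∑ j, X ^ c j - ∑ j, X ^ c' j) :
    BIso n (fun j => (c j : ℤ)) (fun j => (c' j : ℤ)) := by
  obtain ⟨g, hg⟩ := h
  obtain ⟨P, Q, _, _, _, _, p, q, hpq, hX⟩ := KSet.base.mul (n := n) g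
  rw [mul_comm, ← hg] at hX
  -- c + q = c' + p
  have h1 : ∑ j, (X : ℤ[X]) ^ (Sum.elim c q j) = ∑ j, X ^ (Sum.elim c' p j) := by
    simp only [Fintype.sum_sum_type, Sum.elim_inl, Sum.elim_inr]
    linear_combination -hX
  obtain ⟨e, he⟩ := exists_equiv_of_sum_eq h1
  have e0 : Fin (Fintype.card Q) ≃ Q := (Fintype.equivFin Q).symm
  refine BIso.cancel_fin hcard (Fintype.card Q) (fun i => (q (e0 i) : ℤ)) ?_
  have k1 : BIso n (Sum.elim (fun j => (c j : ℤ)) (fun j => (q j : ℤ)))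
      (Sum.elim (fun j => (c' j : ℤ)) (fun j => (p j : ℤ))) := by
    refine BIso.of_equiv e fun j => ?_
    have e1 : ∀ j, Sum.elim (fun j => (c j : ℤ)) (fun j => (q j : ℤ)) j = (Sum.elim c q j : ℕ) := by
      rintro (j | j) <;> rfl
    have e2 : ∀ j, Sum.elim (fun j => (c' j : ℤ)) (fun j => (p j : ℤ)) j = (Sum.elim c' p j : ℕ) := by
      rintro (j | j) <;> rfl
    rw [e1, e2, he]
  have k2 : BIso n (fun i => (q (e0 i) : ℤ)) (fun j => (q j : ℤ)) := BIso.of_equiv e0 fun _ => rfl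
  exact ((BIso.refl _).sum k2).trans (k1.trans ((BIso.refl _).sum (hpq.trans k2.symm)))



lemma coeff_prod {ι : Type} [Fintype ι] (c : ι → ℤ) (k : ℕ) :
    (∏ j, (1 + C (c j) * X) : ℤ[X]).coeff k = MvPolynomial.aeval c (MvPolynomial.esymm ι ℤ k) := by
  classical
  rw [Finset.prod_one_add, MvPolynomial.esymm, finsetSum_coeff, map_sum,
    Finset.powersetCard_eq_filter, Finset.sum_filter]
  refine Finset.sum_congr rfl fun t _ => ?_
  rw [Finset.prod_mul_distrib, Finset.prod_const, ← map_prod, coeff_C_mul, coeff_X_pow]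
  simp [eq_comm]

lemma psum_eq {ι : Type} [Fintype ι] (c c' : ι → ℤ)
    (h : ∀ k ≤ n, MvPolynomial.aeval c (MvPolynomial.esymm ι ℤ k) =
      MvPolynomial.aeval c' (MvPolynomial.esymm ι ℤ k)) (k : ℕ) (hk : k ≤ n) :
    MvPolynomial.aeval c (MvPolynomial.psum ι ℤ k) =
      MvPolynomial.aeval c' (MvPolynomial.psum ι ℤ k) := by
  induction k using Nat.strong_induction_on with
  | _ k ih =>
    rcases Nat.eq_zero_or_pos k with rfl | hpos
    · simp
    · rw [MvPolynomial.psum_eq_mul_esymm_sub_sum ι ℤ k hpos]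
      simp only [map_sub, map_mul, map_sum, map_pow, map_neg, map_one, map_natCast, h k hk]
      congr 1
      refine Finset.sum_congr rfl fun x hx => ?_
      simp only [Finset.mem_filter, Set.mem_Ioo] at hx
      have hx1 := Finset.HasAntidiagonal.mem_antidiagonal.1 hx.1
      rw [h x.1 (by omega), ih x.2 (by omega) (by omega)]

lemma sum_eval_eq {ι : Type} [Fintype ι] (c c' : ι → ℤ)
    (h : ∀ k ≤ n, MvPolynomial.aeval c (MvPolynomial.psum ι ℤ k) =
      MvPolynomial.aeval c' (MvPolynomial.psum ι ℤ k)) (f : ℤ[X]) (hf : f.natDegree ≤ n) :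
    ∑ j, f.eval (c j) = ∑ j, f.eval (c' j) := by
  simp only [eval_eq_sum_range' (Nat.lt_succ_of_le hf)]
  rw [Finset.sum_comm, Finset.sum_comm (s := (Finset.univ : Finset ι))]
  refine Finset.sum_congr rfl fun k hk => ?_
  have := h k (by simpa [Nat.lt_succ_iff] using hk)
  simp only [MvPolynomial.psum, map_sum, map_pow, MvPolynomial.aeval_X] at this
  rw [← Finset.mul_sum, ← Finset.mul_sum, this]

lemma dvd_of_psum {ι : Type} [Fintype ι] (d d' : ι → ℕ)
    (h : ∀ f : ℤ[X], f.natDegree ≤ n → ∑ j, f.eval (d j : ℤ) = ∑ j, f.eval (d' j : ℤ)) :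
    (1 - X : ℤ[X]) ^ (n + 1) ∣ ∑ j, X ^ d j - ∑ j, X ^ d' j := by
  have e : (1 - X : ℤ[X]) ^ (n + 1) = (-1) ^ (n + 1) * (X - C 1) ^ (n + 1) := by
    rw [← mul_pow]; simp
  have hu : IsUnit ((-1 : ℤ[X]) ^ (n + 1)) := isUnit_one.neg.pow _
  rw [e, hu.mul_left_dvd, X_sub_C_pow_dvd_iff, X_pow_dvd_iff]
  intro k hk
  simp only [sub_comp, Polynomial.sum_comp, X_pow_comp, coeff_sub, finsetSum_coeff, map_one, coeff_X_add_one_pow]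
  have h1 := h (descPochhammer ℤ k) (by rw [descPochhammer_natDegree]; omega)
  simp only [descPochhammer_eval_eq_descFactorial, Nat.descFactorial_eq_factorial_mul_choose] at h1
  push_cast at h1
  rw [← Finset.mul_sum, ← Finset.mul_sum] at h1
  rw [mul_left_cancel₀ (by exact_mod_cast k.factorial_ne_zero) h1, sub_self]

lemma biso_of_chern {ι : Type} [Fintype ι] [DecidableEq ι] (c c' : ι → ℤ)
    (h : ∀ k ≤ n, MvPolynomial.aeval c (MvPolynomial.esymm ι ℤ k) =
      MvPolynomial.aeval c' (MvPolynomial.esymm ι ℤ k)) : BIso n c c' := by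
  rcases lt_or_ge n (Fintype.card ι) with hcard | hcard
  · obtain ⟨M, hM⟩ : ∃ M : ℕ, ∀ j, 0 ≤ c j + M ∧ 0 ≤ c' j + M := by
      refine ⟨∑ j, ((c j).natAbs + (c' j).natAbs), fun j => ?_⟩
      have := Finset.single_le_sum (f := fun j => (c j).natAbs + (c' j).natAbs)
        (fun _ _ => Nat.zero_le _) (Finset.mem_univ j)
      omega
    have hd : ∀ j, (((c j + M).toNat : ℕ) : ℤ) = c j + M := fun j => Int.toNat_of_nonneg (hM j).1
    have hd' : ∀ j, (((c' j + M).toNat : ℕ) : ℤ) = c' j + M := fun j => Int.toNat_of_nonneg (hM j).2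
    have key := stable hcard (fun j => (c j + M).toNat) (fun j => (c' j + M).toNat)
      (dvd_of_psum _ _ fun f hf => by
        simp only [hd, hd']
        have := sum_eval_eq c c' (psum_eq c c' h) (f.comp (X + C (M : ℤ))) (by
          rw [natDegree_comp, natDegree_X_add_C]; simpa using hf)
        simpa [eval_comp] using this)
    simp only [hd, hd'] at key
    simpa using key.shift (-(M : ℤ))
  · have hall : ∀ k, (Finset.univ.val.map c).esymm k = (Finset.univ.val.map c').esymm k := by
      intro k
      rcases le_or_gt k n with hk | hk
      · have := h k hk
        rwa [MvPolynomial.aeval_esymm_eq_multiset_esymm, MvPolynomial.aeval_esymm_eq_multiset_esymm] at this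
      · rw [Multiset.esymm, Multiset.esymm, Multiset.powersetCard_eq_empty, Multiset.powersetCard_eq_empty]
        all_goals simp; omega
    have hprod : ((Finset.univ.val.map c).map fun r => (X + C r : ℤ[X])).prod =
        ((Finset.univ.val.map c').map fun r => (X + C r : ℤ[X])).prod := by
      rw [Multiset.prod_X_add_C_eq_sum_esymm, Multiset.prod_X_add_C_eq_sum_esymm]
      simp [hall]
    have hmap : Finset.univ.val.map (fun j => -c j) = Finset.univ.val.map (fun j => -c' j) := by
      have := congrArg Polynomial.roots hprod
      have e : ∀ c : ι → ℤ, ((Finset.univ.val.map c).map fun r => (X + C r : ℤ[X])).prod =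
          ((Finset.univ.val.map (fun j => -c j)).map fun r => (X - C r : ℤ[X])).prod := by
        intro c; simp
      rwa [e, e, roots_multiset_prod_X_sub_C, roots_multiset_prod_X_sub_C] at this
    have hfib : ∀ b, Nonempty ({j // -c j = b} ≃ {j // -c' j = b}) := by
      intro b
      rw [← Fintype.card_eq, Fintype.card_subtype, Fintype.card_subtype]
      have := congrArg (Multiset.count b) hmap
      rw [Multiset.count_map, Multiset.count_map] at this
      simp only [eq_comm (a := b)] at this
      exact this
    refine BIso.of_equiv (Equiv.ofFiberEquiv fun b => (hfib b).some) fun j => ?_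
    exact neg_injective (Equiv.ofFiberEquiv_map (fun b => (hfib b).some) j)

end Stmt19

/-- Let `E = ℂ ⊕ γ^{a₁} ⊕ ⋯ ⊕ γ^{a_m}` be a Whitney sum of powers of the tautological line
bundle `γ` over `ℂPⁿ`, and suppose the total Chern class identity
`(1 - Ax)·∏ⱼ(1 - (A+aⱼ)x) = ∏ⱼ(1 + aⱼx)` holds in `H*(ℂPⁿ) = ℤ[x]/⟨x^{n+1}⟩`.
Then `E* ⊗ γ^{-A} ≅ E` as complex vector bundles over `ℂPⁿ`.

The bundle isomorphism is encoded equivariantly: `γ^k`-twisted sums are associated bundles of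
the principal `ℂ*`-bundle `ℂ^{n+1}∖{0} → ℂPⁿ`, so an isomorphism
`⊕ⱼ γ^{cⱼ} ≅ ⊕ⱼ γ^{c'ⱼ}` is a continuous family `v ↦ g_v` of linear isomorphisms of
`ℂ^{m+1}`, indexed by `v ∈ ℂ^{n+1}∖{0}`, intertwining the `ℂ*`-weights `c = (0,a₁,…,a_m)`
(for `E`) and `c' = (-A, -A-a₁,…,-A-a_m)` (for `E* ⊗ γ^{-A}`). -/
theorem stmt19 (n m : ℕ) (a : Fin m → ℤ) (A : ℤ)
    (h : Ideal.Quotient.mk (Ideal.span ({(X : Polynomial ℤ) ^ (n + 1)} : Set (Polynomial ℤ)))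
        ((1 - C A * X) * ∏ j : Fin m, (1 - C (A + a j) * X)) =
      Ideal.Quotient.mk (Ideal.span ({(X : Polynomial ℤ) ^ (n + 1)} : Set (Polynomial ℤ)))
        (∏ j : Fin m, (1 + C (a j) * X))) :
    ∃ g : {v : Fin (n + 1) → ℂ // v ≠ 0} → ((Fin (m + 1) → ℂ) →ₗ[ℂ] (Fin (m + 1) → ℂ)),
      Continuous (fun p : {v : Fin (n + 1) → ℂ // v ≠ 0} × (Fin (m + 1) → ℂ) => g p.1 p.2) ∧
      (∀ v, Function.Bijective (g v)) ∧
      ∀ (ζ : ℂ) (hζ : ζ ≠ 0) (v : {v : Fin (n + 1) → ℂ // v ≠ 0})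
        (hζv : ζ • (v : Fin (n + 1) → ℂ) ≠ 0) (wvec : Fin (m + 1) → ℂ),
        g ⟨ζ • (v : Fin (n + 1) → ℂ), hζv⟩
            (fun j => ζ ^ ((Fin.cons 0 a : Fin (m + 1) → ℤ) j) * wvec j) =
          fun j => ζ ^ ((Fin.cons (-A) (fun j' => -A - a j') : Fin (m + 1) → ℤ) j) * g v wvec j := by
  have hP : (∏ j, (1 + C ((Fin.cons 0 a : Fin (m + 1) → ℤ) j) * X) : ℤ[X]) =
      ∏ j : Fin m, (1 + C (a j) * X) := by
    rw [Fin.prod_univ_succ]; simp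
  have hQ : (∏ j, (1 + C ((Fin.cons (-A) (fun j' => -A - a j') : Fin (m + 1) → ℤ) j) * X) : ℤ[X]) =
      (1 - C A * X) * ∏ j : Fin m, (1 - C (A + a j) * X) := by
    rw [Fin.prod_univ_succ]
    congr 1
    · simp only [Fin.cons_zero, map_neg]; ring
    · refine Finset.prod_congr rfl fun j _ => ?_
      simp only [Fin.cons_succ, map_sub, map_neg, map_add]; ring
  rw [← hP, ← hQ, Ideal.Quotient.eq, Ideal.mem_span_singleton, X_pow_dvd_iff] at h
  obtain ⟨G, H, hG, -, hGH⟩ := Stmt19.biso_of_chern (n := n)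
    (Fin.cons 0 a : Fin (m + 1) → ℤ) (Fin.cons (-A) (fun j' => -A - a j') : Fin (m + 1) → ℤ) (by
      intro k hk
      have := h k (by omega)
      rw [coeff_sub, sub_eq_zero, Stmt19.coeff_prod, Stmt19.coeff_prod] at this
      exact this.symm)
  refine ⟨fun v => Matrix.toLin' (G v), ?_, ?_, ?_⟩
  · simp only [Matrix.toLin'_apply]
    refine continuous_pi fun k => ?_
    simp only [Matrix.mulVec, dotProduct]
    refine continuous_finsetSum _ fun j _ => Continuous.mul ?_ ((continuous_apply j).comp continuous_snd)
    have h1 : Continuous (fun v : {v : Fin (n + 1) → ℂ // v ≠ 0} => G v k j) :=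
      continuous_iff_continuousAt.2 fun v =>
        ContinuousAt.comp (f := fun v : {v : Fin (n + 1) → ℂ // v ≠ 0} => (v : Fin (n + 1) → ℂ))
          (g := fun v => G v k j) ((hG k j).1 v v.2).continuousAt continuous_subtype_val.continuousAt
    exact h1.comp continuous_fst
  · intro v
    obtain ⟨h1, h2⟩ := hGH v v.2
    refine Function.bijective_iff_has_inverse.2 ⟨Matrix.toLin' (H v), fun w => ?_, fun w => ?_⟩
    · simp [Matrix.mulVec_mulVec, h2]
    · simp [Matrix.mulVec_mulVec, h1]
  · intro ζ hζ v hζv w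
    funext k
    simp only [Matrix.toLin'_apply, Matrix.mulVec, dotProduct, Finset.mul_sum]
    refine Finset.sum_congr rfl fun j _ => ?_
    have := (hG k j).2 ζ hζ v v.2
    simp only at this
    rw [this, zpow_sub₀ hζ]
    have hz := zpow_ne_zero ((Fin.cons 0 a : Fin (m + 1) → ℤ) j) hζ
    field_simp
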